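/- Let k be an algebraically closed field of characteristic p > 0, let G be a normal subgroup of a finite group G̃, let B be a block of kG, and let M and M' be I_{G̃}(B)-invariant support τ-tilting B-modules. Then M ≥ M' in the partial order on support τ-tilting B-modules if and only if Ind_G^{G̃} M ≥ Ind_G^{G̃} M' in the partial order on support τ-tilting kG̃-modules. -/

import Mathlib

/-!
Common definitions: τ-tilting theory over a ring, blocks of group algebras,
conjugate modules and induced modules.

Since group algebras (and their blocks) are symmetric algebras, the
Auslander–Reiten translate is `τ = Ω²` computed via (minimal) projective covers;
τ-rigidity is formulated accordingly.  Support τ-tilting modules are formulated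
via support τ-tilting pairs: `M` is support τ-tilting iff `M` is τ-rigid and
there is a projective module `P` with `Hom(P, M) = 0` and `|M| + |P| = |Λ|`
(the number of simple modules), which is the standard equivalent
characterisation (Adachi–Iyama–Reiten, Prop. 2.3; Remark 2.2 of the paper).
-/

universe u

section GeneralDefs

variable (A : Type u) [Ring A]

/-- A module is indecomposable if it is nontrivial and has no nontrivial
direct sum decomposition. -/
def IsIndecModule (X : Type u) [AddCommGroup X] [Module A X] : Prop :=
  Nontrivial X ∧ ∀ U V : Submodule A X, IsCompl U V → U = ⊥ ∨ V = ⊥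

/-- `|M|`: the number of isomorphism classes of indecomposable direct summands
of `M`. -/
noncomputable def numIndec (M : Type u) [AddCommGroup M] [Module A M] : ℕ :=
  Nat.card (Quot fun
    (L L' : {L : Submodule A M // (∃ L'', IsCompl L L'') ∧ IsIndecModule A L}) =>
      Nonempty (L.1 ≃ₗ[A] L'.1))

/-- `|A|`: the number of isomorphism classes of simple `A`-modules. -/
noncomputable def numSimples : ℕ :=
  Nat.card (Quot fun (X Y : {X : ModuleCat.{u} A // IsSimpleModule A X}) =>
    Nonempty ((X.1 : Type u) ≃ₗ[A] (Y.1 : Type u)))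

/-- The number of isomorphism classes of simple `A`-modules lying in the block
with block idempotent `b` (i.e. on which `b` acts as the identity). -/
noncomputable def numSimplesIn (b : A) : ℕ :=
  Nat.card (Quot fun
    (X Y : {X : ModuleCat.{u} A //
        IsSimpleModule A X ∧ ∀ v : (X : Type u), b • v = v}) =>
      Nonempty ((X.1 : Type u) ≃ₗ[A] (Y.1 : Type u)))

/-- `π : P → M` is a projective cover: `P` is projective, `π` is surjective and
`ker π` is superfluous (i.e. `π` is an essential epimorphism). -/
def IsProjCover {P M : Type u} [AddCommGroup P] [Module A P]
    [AddCommGroup M] [Module A M] (π : P →ₗ[A] M) : Prop :=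
  Module.Projective A P ∧ Function.Surjective π ∧
    ∀ N : Submodule A P, N ⊔ LinearMap.ker π = ⊤ → N = ⊤

/-- `M` is τ-rigid: `Hom(M, τ M) = 0`, where for the symmetric algebras
considered here `τ M = Ω² M` is computed from minimal projective presentations:
for (any) projective cover `π₀ : P₀ → M` and projective cover
`π₁ : P₁ → ker π₀`, one has `τ M = ker π₁`. -/
def IsTauRigid (M : Type u) [AddCommGroup M] [Module A M] : Prop :=
  ∀ (P₀ : Type u) [AddCommGroup P₀] [Module A P₀] (π₀ : P₀ →ₗ[A] M),
    IsProjCover A π₀ →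
    ∀ (P₁ : Type u) [AddCommGroup P₁] [Module A P₁]
      (π₁ : P₁ →ₗ[A] ↥(LinearMap.ker π₀)),
      IsProjCover A π₁ →
      ∀ g : M →ₗ[A] ↥(LinearMap.ker π₁), g = 0

/-- `M` is a support τ-tilting `A`-module (via support τ-tilting pairs):
`M` is τ-rigid and there is a (finitely generated) projective `A`-module `P`
with `Hom_A(P, M) = 0` and `|M| + |P| = |A|`. -/
def IsSupportTauTilting (M : Type u) [AddCommGroup M] [Module A M] : Prop :=
  IsTauRigid A M ∧
  ∃ P : ModuleCat.{u} A, Module.Projective A P ∧ Module.Finite A P ∧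
    (∀ f : (P : Type u) →ₗ[A] M, f = 0) ∧
    numIndec A M + numIndec A (P : Type u) = numSimples A

/-- `b` is a block idempotent: a primitive central idempotent of `A`.
The corresponding block is `B = A * b`. -/
def IsBlockIdem (b : A) : Prop :=
  b ≠ 0 ∧ b * b = b ∧ (∀ r : A, b * r = r * b) ∧
  ∀ c : A, c * c = c → (∀ r : A, c * r = r * c) → b * c = c → c = 0 ∨ c = b

/-- `M` is a support τ-tilting module over the block `B` with block idempotent
`b`: `M` lies in `B`, is τ-rigid (over `B`, equivalently over `A`) and there is
a projective module `P` lying in `B` with `Hom(P, M) = 0` and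
`|M| + |P| = |B|`. -/
def IsSupportTauTiltingBlock (b : A) (M : Type u) [AddCommGroup M]
    [Module A M] : Prop :=
  (∀ m : M, b • m = m) ∧ IsTauRigid A M ∧
  ∃ P : ModuleCat.{u} A, Module.Projective A P ∧ Module.Finite A P ∧
    (∀ v : (P : Type u), b • v = v) ∧
    (∀ f : (P : Type u) →ₗ[A] M, f = 0) ∧
    numIndec A M + numIndec A (P : Type u) = numSimplesIn A b

/-- The partial order on support τ-tilting modules: `M ≥ M'` iff there are
`r > 0` and an epimorphism `M^{⊕ r} ↠ M'`. -/
def stGE (M M' : Type u) [AddCommGroup M] [Module A M]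
    [AddCommGroup M'] [Module A M'] : Prop :=
  ∃ r : ℕ, 0 < r ∧ ∃ φ : (Fin r → M) →ₗ[A] M', Function.Surjective φ

/-- `X ∈ add M`: `X` is a direct summand of a finite direct sum of copies
of `M`. -/
def InAdd (M X : Type u) [AddCommGroup M] [Module A M]
    [AddCommGroup X] [Module A X] : Prop :=
  ∃ (n : ℕ) (i : X →ₗ[A] (Fin n → M)) (p : (Fin n → M) →ₗ[A] X),
    p.comp i = LinearMap.id

/-- For a central idempotent `b` of `A`, the direct summand `b • N` of an
`A`-module `N`, realised as the submodule of elements on which `b` acts as the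
identity. -/
def blockComponent (b : A) (hb : ∀ r : A, b * r = r * b)
    (N : Type u) [AddCommGroup N] [Module A N] : Submodule A N where
  carrier := {n | b • n = n}
  add_mem' := by
    intro a c ha hc
    simp only [Set.mem_setOf_eq, smul_add] at *
    rw [ha, hc]
  zero_mem' := by simp
  smul_mem' := by
    intro r n hn
    simp only [Set.mem_setOf_eq] at *
    rw [← mul_smul, hb, mul_smul, hn]

end GeneralDefs

section InducedDefs

/-- `(N, j)` is the module induced from `M` along the ring homomorphism
`ι : R →+* S`, i.e. `N ≅ S ⊗_R M`, characterised by the universal property of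
extension of scalars: `j : M → N` is `R`-linear (with `R` acting on `N` via
`ι`) and every `R`-linear map from `M` to (the restriction of) an `S`-module
`X` factors uniquely through an `S`-linear map `N → X`. -/
def IsInducedMod {R S : Type u} [Ring R] [Ring S] (ι : R →+* S)
    (M : Type u) [AddCommGroup M] [Module R M]
    (N : Type u) [AddCommGroup N] [Module S N] (j : M →+ N) : Prop :=
  (∀ (r : R) (m : M), j (r • m) = ι r • j m) ∧
  ∀ (X : Type u) [AddCommGroup X] [Module S X] (f : M →+ X),
    (∀ (r : R) (m : M), f (r • m) = ι r • f m) →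
    ∃! g : N →ₗ[S] X, ∀ m : M, g (j m) = f m

end InducedDefs

section GroupDefs

variable (k : Type u) [Field k] (Gt : Type u) [Group Gt] (G : Subgroup Gt)
  [G.Normal]

/-- The ring automorphism of `kG` induced by conjugation by `x ∈ G̃` on the
normal subgroup `G`. -/
noncomputable def conjRingHom (x : Gt) :
    MonoidAlgebra k ↥G →+* MonoidAlgebra k ↥G :=
  MonoidAlgebra.mapDomainRingHom k (MulAut.conjNormal (H := G) x)

/-- The ring homomorphism `kG →+* kG̃` induced by the inclusion `G ≤ G̃`. -/
noncomputable def inclRingHom : MonoidAlgebra k ↥G →+* MonoidAlgebra k Gt :=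
  MonoidAlgebra.mapDomainRingHom k G.subtype

/-- `x M ≅ M`: the conjugate module `x M` (with `g` acting as `x⁻¹ g x` does
on `M`) is isomorphic to `M`; equivalently, there is an additive automorphism
of `M` which is semilinear for the conjugation automorphism of `kG`. -/
def IsConjStable (x : Gt) (M : Type u) [AddCommGroup M]
    [Module (MonoidAlgebra k ↥G) M] : Prop :=
  ∃ φ : M ≃+ M, ∀ (r : MonoidAlgebra k ↥G) (m : M),
    φ (conjRingHom k Gt G x r • m) = r • φ m

end GroupDefs

section InducedModules

variable {R S : Type u} [Ring R] [Ring S] {ι : R →+* S}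
  {M : Type u} [AddCommGroup M] [Module R M] {N : Type u} [AddCommGroup N] [Module S N]
  {j : M →+ N}

theorem IsInducedMod.span_range_eq_top (h : IsInducedMod ι M N j) :
    Submodule.span S (Set.range j) = ⊤ := by
  obtain ⟨g, -, hg⟩ := h.2 (N ⧸ Submodule.span S (Set.range j)) 0 (by simp)
  have hq : (Submodule.span S (Set.range j)).mkQ = 0 := by
    rw [hg 0 (by simp)]
    refine hg _ fun m => ?_
    simpa using Submodule.subset_span (Set.mem_range_self m)
  rw [← Submodule.ker_mkQ (Submodule.span S (Set.range j)), hq, LinearMap.ker_zero]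

/-- A bimodule retraction `π` of `ι` induces a retraction of `j : M → N`. -/
theorem IsInducedMod.exists_retraction (h : IsInducedMod ι M N j) (π : S →+ R)
    (hone : π 1 = 1) (hleft : ∀ r s, π (ι r * s) = r * π s)
    (hright : ∀ r s, π (s * ι r) = π s * r) :
    ∃ q : N →+ M, (∀ m, q (j m) = m) ∧ ∀ (r : R) (n : N), q (ι r • n) = r • q n := by
  let f : M →+ ((ModuleCat.restrictScalars ι).obj (ModuleCat.of S S) →ₗ[R] M) :=
    { toFun := fun m =>
        { toFun := fun s : S => π s • m
          map_add' := fun s t : S => by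
            change π (s + t) • m = _
            rw [map_add, add_smul]
          map_smul' := fun r (s : S) => by
            change π (ι r * s) • m = r • π s • m
            rw [hleft, mul_smul] }
      map_zero' := by ext s; exact smul_zero _
      map_add' := fun m m' => by ext s; exact smul_add _ _ _ }
  obtain ⟨g, hg, -⟩ := h.2 _ f fun r m => LinearMap.ext fun s : S => by
    change π s • r • m = π (s * ι r) • m
    rw [hright, mul_smul]
  refine ⟨⟨⟨fun n => g n (1 : S), ?_⟩, ?_⟩, ?_, ?_⟩
  · change g 0 (1 : S) = 0
    rw [map_zero]; rfl
  · intro a c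
    change g (a + c) (1 : S) = g a (1 : S) + g c (1 : S)
    rw [map_add]; rfl
  · intro m
    change g (j m) (1 : S) = m
    rw [hg]
    change π 1 • m = m
    rw [hone, one_smul]
  · intro r n
    change g (ι r • n) (1 : S) = r • g n (1 : S)
    rw [map_smul]
    refine Eq.trans ?_ ((g n).map_smul r (1 : S))
    change g n ((1 : S) * ι r : S) = g n (ι r * (1 : S) : S)
    rw [one_mul, mul_one]

/-- Induction preserves the order `stGE`. -/
theorem stGE.induced {M' : Type u} [AddCommGroup M'] [Module R M']
    {N' : Type u} [AddCommGroup N'] [Module S N'] {j' : M' →+ N'}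
    (hN : IsInducedMod ι M N j) (hN' : IsInducedMod ι M' N' j') (h : stGE R M M') :
    stGE S N N' := by
  obtain ⟨r, hr, φ, hφ⟩ := h
  have hext (i : Fin r) : ∃ g : N →ₗ[S] N', ∀ m, g (j m) = j' (φ (Pi.single i m)) := by
    obtain ⟨g, hg, -⟩ := hN.2 N'
      (j'.comp (φ.comp (LinearMap.single R (fun _ : Fin r => M) i)).toAddMonoidHom)
      (fun s m => by
        change j' ((φ.comp (LinearMap.single R (fun _ : Fin r => M) i)) (s • m)) = _
        rw [map_smul, hN'.1]; rfl)
    exact ⟨g, hg⟩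
  choose g hg using hext
  refine ⟨r, hr, LinearMap.lsum S (fun _ : Fin r => N) ℕ g, ?_⟩
  rw [← LinearMap.range_eq_top, eq_top_iff, ← hN'.span_range_eq_top, Submodule.span_le]
  rintro _ ⟨m', rfl⟩
  obtain ⟨v, rfl⟩ := hφ m'
  refine ⟨fun i => j (v i), ?_⟩
  rw [LinearMap.lsum_apply, LinearMap.sum_apply]
  simp only [LinearMap.comp_apply, LinearMap.proj_apply, hg]
  rw [← map_sum, ← map_sum, Finset.univ_sum_single]

end InducedModules

theorem stGE_of_iSup_range_eq_top {R M M' : Type u} [Ring R] [AddCommGroup M] [Module R M]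
    [AddCommGroup M'] [Module R M'] [Module.Finite R M']
    (h : ⨆ f : M →ₗ[R] M', LinearMap.range f = ⊤) : stGE R M M' := by
  classical
  obtain ⟨s, hs⟩ := CompleteLattice.IsCompactElement.exists_finset_of_le_iSup _
    ((Submodule.fg_iff_compact _).1 (Module.Finite.fg_top (R := R) (M := M')))
    (fun f : M →ₗ[R] M' => LinearMap.range f) h.ge
  let t := insert (0 : M →ₗ[R] M') s
  refine ⟨t.card, Finset.card_pos.2 (Finset.insert_nonempty _ _),
    LinearMap.lsum R (fun _ : Fin t.card => M) ℕ fun i => (t.equivFin.symm i).1, ?_⟩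
  rw [← LinearMap.range_eq_top, eq_top_iff]
  refine hs.trans (iSup₂_le fun f hf => ?_)
  rintro _ ⟨m, rfl⟩
  refine ⟨Pi.single (t.equivFin ⟨f, Finset.mem_insert_of_mem hf⟩) m, ?_⟩
  rw [LinearMap.lsum_piSingle, Equiv.symm_apply_apply]

section GroupAlgebras

variable (k : Type u) [Field k] (Gt : Type u) [Group Gt] (G : Subgroup Gt)

theorem MonoidAlgebra.comapDomain_subtype_incl_mul (r : MonoidAlgebra k ↥G)
    (s : MonoidAlgebra k Gt) :
    MonoidAlgebra.comapDomain G.subtype G.subtype_injective (inclRingHom k Gt G r * s) =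
      r * MonoidAlgebra.comapDomain G.subtype G.subtype_injective s := by
  induction r using MonoidAlgebra.induction_linear with
  | zero => simp
  | add x y hx hy => simp only [map_add, add_mul, MonoidAlgebra.comapDomain_add, hx, hy]
  | single g c =>
    ext h
    simp [inclRingHom]

theorem MonoidAlgebra.comapDomain_subtype_mul_incl (r : MonoidAlgebra k ↥G)
    (s : MonoidAlgebra k Gt) :
    MonoidAlgebra.comapDomain G.subtype G.subtype_injective (s * inclRingHom k Gt G r) =
      MonoidAlgebra.comapDomain G.subtype G.subtype_injective s * r := by
  induction r using MonoidAlgebra.induction_linear with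
  | zero => simp
  | add x y hx hy => simp only [map_add, mul_add, MonoidAlgebra.comapDomain_add, hx, hy]
  | single g c =>
    ext h
    simp [inclRingHom]

variable [G.Normal]

theorem inclRingHom_conjRingHom_mul_single (x : Gt) (r : MonoidAlgebra k ↥G) :
    inclRingHom k Gt G (conjRingHom k Gt G x r) * MonoidAlgebra.single x 1 =
      MonoidAlgebra.single x 1 * inclRingHom k Gt G r := by
  induction r using MonoidAlgebra.induction_linear with
  | zero => simp
  | add s t hs ht => simp only [map_add, add_mul, mul_add, hs, ht]
  | single g c => simp [inclRingHom, conjRingHom, MonoidAlgebra.single_mul_single]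

theorem conjRingHom_conjRingHom_inv (x : Gt) (r : MonoidAlgebra k ↥G) :
    conjRingHom k Gt G x (conjRingHom k Gt G x⁻¹ r) = r := by
  induction r using MonoidAlgebra.induction_linear with
  | zero => simp
  | add s t hs ht => simp only [map_add, hs, ht]
  | single g c => simp [conjRingHom]

theorem conjRingHom_inv_conjRingHom (x : Gt) (r : MonoidAlgebra k ↥G) :
    conjRingHom k Gt G x⁻¹ (conjRingHom k Gt G x r) = r := by
  simpa using conjRingHom_conjRingHom_inv k Gt G x⁻¹ r

end GroupAlgebras

theorem IsBlockIdem.map {A : Type u} [Ring A] {b : A} (hb : IsBlockIdem A b)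
    (σ τ : A →+* A) (hστ : ∀ a, σ (τ a) = a) (hτσ : ∀ a, τ (σ a) = a) :
    IsBlockIdem A (σ b) := by
  obtain ⟨hb0, hbb, hbc, hbp⟩ := hb
  refine ⟨fun h => hb0 ?_, by rw [← map_mul, hbb], fun r => ?_, fun c hc hcc hbc' => ?_⟩
  · rw [← hτσ b, h, map_zero]
  · rw [← hστ r, ← map_mul, hbc, map_mul]
  · have := hbp (τ c) (by rw [← map_mul, hc])
      (fun r => by rw [← hτσ r, ← map_mul, hcc, map_mul])
      (by rw [← hτσ b, ← map_mul, hbc'])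
    rcases this with h | h
    · exact Or.inl (by rw [← hστ c, h, map_zero])
    · exact Or.inr (by rw [← hστ c, h])

theorem IsBlockIdem.mul_eq_zero_of_ne {A : Type u} [Ring A] {b c : A}
    (hb : IsBlockIdem A b) (hc : IsBlockIdem A c) (hne : b ≠ c) : b * c = 0 := by
  obtain ⟨-, hbb, hbc, hbp⟩ := hb
  obtain ⟨-, hcc, hcc', hcp⟩ := hc
  have hidem : b * c * (b * c) = b * c := by
    rw [mul_assoc, ← mul_assoc c, hcc' b, mul_assoc b c c, hcc, ← mul_assoc, hbb]
  have hcent (r : A) : b * c * r = r * (b * c) := by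
    rw [mul_assoc, hcc', ← mul_assoc, hbc, mul_assoc]
  rcases hbp _ hidem hcent (by rw [← mul_assoc, hbb]) with h | h
  · exact h
  · rcases hcp _ hidem hcent (by rw [hbc, ← mul_assoc, hcc]) with h' | h'
    · exact h'
    · exact absurd (h.symm.trans h') hne

/-- If `b` is a block idempotent acting as the identity on `M` and `M` is invariant under the
inertial group of `b`, then `stGE` for induced modules implies `stGE` for the original ones. -/
theorem stGE_of_stGE_induced
    {k : Type u} [Field k] {Gt : Type u} [Group Gt] {G : Subgroup Gt} [G.Normal]
    {b : MonoidAlgebra k ↥G} (hb : IsBlockIdem (MonoidAlgebra k ↥G) b)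
    {M : Type u} [AddCommGroup M] [Module (MonoidAlgebra k ↥G) M]
    {M' : Type u} [AddCommGroup M'] [Module (MonoidAlgebra k ↥G) M']
    [Module.Finite (MonoidAlgebra k ↥G) M']
    (hbM : ∀ m : M, b • m = m) (hbM' : ∀ m : M', b • m = m)
    (hinv : ∀ x : Gt, conjRingHom k Gt G x b = b → IsConjStable k Gt G x M)
    {N : Type u} [AddCommGroup N] [Module (MonoidAlgebra k Gt) N]
    {j : M →+ N} (hN : IsInducedMod (inclRingHom k Gt G) M N j)
    {N' : Type u} [AddCommGroup N'] [Module (MonoidAlgebra k Gt) N']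
    {j' : M' →+ N'} (hN' : IsInducedMod (inclRingHom k Gt G) M' N' j')
    (h : stGE (MonoidAlgebra k Gt) N N') : stGE (MonoidAlgebra k ↥G) M M' := by
  obtain ⟨q, hqj, hq⟩ := hN'.exists_retraction
    (MonoidAlgebra.comapDomainAddMonoidHom G.subtype G.subtype_injective)
    (by
      change MonoidAlgebra.comapDomain G.subtype G.subtype_injective 1 = 1
      rw [MonoidAlgebra.one_def, MonoidAlgebra.one_def, ← map_one G.subtype,
        MonoidAlgebra.comapDomain_single_map])
    (MonoidAlgebra.comapDomain_subtype_incl_mul k Gt G)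
    (MonoidAlgebra.comapDomain_subtype_mul_incl k Gt G)
  set T := ⨆ f : M →ₗ[MonoidAlgebra k ↥G] M', LinearMap.range f with hT
  have htrans (Ψ : N →ₗ[MonoidAlgebra k Gt] N') (x : Gt) (m : M) :
      b • q (Ψ (MonoidAlgebra.single x (1 : k) • j m)) ∈ T := by
    by_cases hx : conjRingHom k Gt G x b = b
    · obtain ⟨φ, hφ⟩ := hinv x hx
      let f : M →ₗ[MonoidAlgebra k ↥G] M' :=
        { toFun := fun m => q (Ψ (MonoidAlgebra.single x (1 : k) • j (φ m)))
          map_add' := fun m m' => by simp only [map_add, smul_add]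
          map_smul' := fun r m => by
            conv_lhs => rw [← conjRingHom_conjRingHom_inv k Gt G x r]
            rw [hφ, hN.1, ← mul_smul, ← inclRingHom_conjRingHom_mul_single,
              conjRingHom_conjRingHom_inv, mul_smul, map_smul, hq, RingHom.id_apply] }
      rw [hbM']
      refine hT ▸ Submodule.mem_iSup_of_mem f ⟨φ.symm m, ?_⟩
      change q (Ψ (MonoidAlgebra.single x (1 : k) • j (φ (φ.symm m)))) = _
      rw [φ.apply_symm_apply]
    · have hb' : IsBlockIdem _ (conjRingHom k Gt G x⁻¹ b) :=
        hb.map _ (conjRingHom k Gt G x) (conjRingHom_inv_conjRingHom k Gt G x)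
          (conjRingHom_conjRingHom_inv k Gt G x)
      have hne : conjRingHom k Gt G x⁻¹ b ≠ b := fun h => hx <| by
        conv_lhs => rw [← h]
        rw [conjRingHom_conjRingHom_inv]
      have hzero : conjRingHom k Gt G x⁻¹ b • m = 0 := by
        rw [← hbM m, ← mul_smul, hb'.mul_eq_zero_of_ne hb hne, zero_smul]
      rw [← hq, ← map_smul, ← mul_smul]
      conv in inclRingHom k Gt G b => rw [← conjRingHom_conjRingHom_inv k Gt G x b]
      rw [inclRingHom_conjRingHom_mul_single, mul_smul, ← hN.1, hzero]
      simp
  have hmem (Ψ : N →ₗ[MonoidAlgebra k Gt] N') (n : N) (a : MonoidAlgebra k Gt) :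
      b • q (Ψ (a • n)) ∈ T := by
    have hn : n ∈ Submodule.span (MonoidAlgebra k Gt) (Set.range j) :=
      hN.span_range_eq_top ▸ Submodule.mem_top
    induction hn using Submodule.span_induction generalizing a with
    | mem n hn =>
      obtain ⟨m, rfl⟩ := hn
      induction a using MonoidAlgebra.induction_linear with
      | zero => simp
      | add s t hs ht => simpa only [add_smul, map_add, smul_add] using T.add_mem hs ht
      | single x c =>
        have hsingle : MonoidAlgebra.single x c =
            MonoidAlgebra.single x 1 * inclRingHom k Gt G (MonoidAlgebra.single 1 c) := by
          simp [inclRingHom, MonoidAlgebra.single_mul_single]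
        rw [hsingle, mul_smul, ← hN.1]
        exact htrans Ψ x _
    | zero => simp
    | add n n' _ _ hn hn' =>
      simpa only [smul_add, map_add] using T.add_mem (hn a) (hn' a)
    | smul s n _ hn => simpa only [mul_smul] using hn (a * s)
  obtain ⟨r, -, Φ, hΦ⟩ := h
  refine stGE_of_iSup_range_eq_top (eq_top_iff.2 fun m' _ => ?_)
  obtain ⟨v, hv⟩ := hΦ (j' m')
  rw [← hbM' m', ← hqj m', ← hv, ← Finset.univ_sum_single v, map_sum, map_sum, Finset.smul_sum]
  refine T.sum_mem fun i _ => ?_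
  simpa using hmem (Φ.comp (LinearMap.single _ (fun _ : Fin r => N) i)) (v i) 1

/-- For `I_{G̃}(B)`-invariant support τ-tilting `B`-modules
`M, M'`: `M ≥ M'` in `sτ-tilt B` iff `Ind M ≥ Ind M'` in `sτ-tilt kG̃`. -/
theorem stGE_iff_stGE_induced
    (k : Type u) [Field k] [IsAlgClosed k] (p : ℕ) (hp : 0 < p) [CharP k p]
    (Gt : Type u) [Group Gt] [Fintype Gt] (G : Subgroup Gt) [G.Normal]
    (b : MonoidAlgebra k ↥G) (hb : IsBlockIdem (MonoidAlgebra k ↥G) b)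
    (M : Type u) [AddCommGroup M] [Module (MonoidAlgebra k ↥G) M]
    [Module.Finite (MonoidAlgebra k ↥G) M]
    (M' : Type u) [AddCommGroup M'] [Module (MonoidAlgebra k ↥G) M']
    [Module.Finite (MonoidAlgebra k ↥G) M']
    (hst : IsSupportTauTiltingBlock (MonoidAlgebra k ↥G) b M)
    (hst' : IsSupportTauTiltingBlock (MonoidAlgebra k ↥G) b M')
    (hinv : ∀ x : Gt, conjRingHom k Gt G x b = b → IsConjStable k Gt G x M)
    (hinv' : ∀ x : Gt, conjRingHom k Gt G x b = b → IsConjStable k Gt G x M')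
    (N : Type u) [AddCommGroup N] [Module (MonoidAlgebra k Gt) N]
    (jM : M →+ N) (hN : IsInducedMod (inclRingHom k Gt G) M N jM)
    (N' : Type u) [AddCommGroup N'] [Module (MonoidAlgebra k Gt) N']
    (jM' : M' →+ N') (hN' : IsInducedMod (inclRingHom k Gt G) M' N' jM') :
    stGE (MonoidAlgebra k ↥G) M M' ↔ stGE (MonoidAlgebra k Gt) N N' := by
  exact ⟨fun h => h.induced hN hN', stGE_of_stGE_induced hb hst.1 hst'.1 hinv hN hN'⟩
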